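/- Let W be a channel with arbitrary input alphabet 𝒳 and finite output alphabet 𝒴, and suppose there exists a continuous map γ : [0,1] → 𝒫(𝒴) (with 𝒫(𝒴) carrying the total variation metric) such that γ(0) ≠ γ(1) and γ(t) ∈ { W_x : x ∈ 𝒳 } for all t ∈ [0,1]. Then for every λ₁, λ₂ > 0, liminf_{n→∞} (1/(n log₂ n)) · log₂ N_DI(n,λ₁,λ₂) ≥ 1/4. -/

import Mathlib

open Real Filter

namespace DIChannel

variable {X Y : Type*}

/-- `p` is a probability distribution on the finite alphabet `Y`. -/
def IsDist [Fintype Y] (p : Y → ℝ) : Prop := (∀ y, 0 ≤ p y) ∧ ∑ y, p y = 1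

/-- Product (memoryless) output distribution `W_{x^n}` on `Y^n`. -/
noncomputable def prodP [Fintype Y] (W : X → Y → ℝ) {n : ℕ} (u : Fin n → X)
    (y : Fin n → Y) : ℝ := ∏ i, W (u i) (y i)

/-- Total variation distance `½‖p − q‖₁` between distributions on a finite set. -/
noncomputable def tvd {Z : Type*} [Fintype Z] (p q : Z → ℝ) : ℝ := (∑ z, |p z - q z|) / 2

/-- Probability of a set of output words under `W_{x^n}`. -/
noncomputable def probOf [Fintype Y] (W : X → Y → ℝ) {n : ℕ} (u : Fin n → X)
    (E : Finset (Fin n → Y)) : ℝ := ∑ y ∈ E, prodP W u y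

/-- An `(n,N,λ₁,λ₂)`-deterministic identification code for the channel `W`. -/
def diCode [Fintype Y] (W : X → Y → ℝ) (n N : ℕ) (l1 l2 : ℝ) : Prop :=
  ∃ (u : Fin N → Fin n → X) (E : Fin N → Finset (Fin n → Y)),
    (∀ j, 1 - l1 ≤ probOf W (u j) (E j)) ∧
    (∀ j k, j ≠ k → probOf W (u j) (E k) ≤ l2)

end DIChannel

open DIChannel


/-- Expectation of a product function under a product distribution. -/
lemma di_prod_expect {Y : Type*} [Fintype Y] {n : ℕ} (w g : Fin n → Y → ℝ) :
    ∑ y : Fin n → Y, (∏ i, w i (y i)) * ∏ i, g i (y i) = ∏ i, ∑ z, w i z * g i z := by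
  classical
  rw [Finset.prod_univ_sum, Fintype.piFinset_univ]
  simp [Finset.prod_mul_distrib]

lemma di_prod_sum_one {Y : Type*} [Fintype Y] {n : ℕ} (w : Fin n → Y → ℝ)
    (hw : ∀ i, IsDist (w i)) : ∑ y : Fin n → Y, (∏ i, w i (y i)) = 1 := by
  have := di_prod_expect w (fun _ _ => 1)
  simpa [fun i => (hw i).2] using this

lemma di_second_moment {Y : Type*} [Fintype Y] {n : ℕ} (w f : Fin n → Y → ℝ)
    (hw : ∀ i, IsDist (w i)) (hf0 : ∀ i, ∑ z, w i z * f i z = 0)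
    (hf1 : ∀ i, ∑ z, w i z * (f i z)^2 ≤ 1) :
    ∑ y : Fin n → Y, (∏ i, w i (y i)) * (∑ i, f i (y i))^2 ≤ n := by
  classical
  have key : ∀ i j : Fin n, ∑ y : Fin n → Y, (∏ k, w k (y k)) * (f i (y i) * f j (y j))
      ≤ if i = j then 1 else 0 := by
    intro i j
    by_cases hij : i = j
    · subst hij
      simp only [if_true]
      have h := di_prod_expect w (fun k z => if k = i then (f i z)^2 else 1)
      have e1 : ∀ y : Fin n → Y, (∏ k, if k = i then (f i (y k))^2 else 1) = f i (y i) * f i (y i) := by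
        intro y
        rw [Finset.prod_ite_eq' Finset.univ i (fun k => (f i (y k))^2)]
        simp [sq]
      simp only [e1] at h
      rw [h]
      have : ∀ k, (∑ z, w k z * (if k = i then (f i z)^2 else 1))
          = if k = i then ∑ z, w k z * (f k z)^2 else 1 := by
        intro k
        split_ifs with hk
        · subst hk; rfl
        · simpa using (hw k).2
      simp only [this]
      rw [Finset.prod_ite_eq' Finset.univ i]
      simpa using hf1 i
    · simp only [hij, if_false]
      have h := di_prod_expect w
        (fun k z => (if k = i then f i z else 1) * (if k = j then f j z else 1))
      have e1 : ∀ y : Fin n → Y, (∏ k, ((if k = i then f i (y k) else 1) *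
          (if k = j then f j (y k) else 1))) = f i (y i) * f j (y j) := by
        intro y
        rw [Finset.prod_mul_distrib, Finset.prod_ite_eq' Finset.univ i (fun k => f i (y k)),
          Finset.prod_ite_eq' Finset.univ j (fun k => f j (y k))]
        simp
      simp only [e1] at h
      rw [h]
      apply le_of_eq
      apply Finset.prod_eq_zero (Finset.mem_univ i)
      simpa [hij] using hf0 i
  calc ∑ y : Fin n → Y, (∏ i, w i (y i)) * (∑ i, f i (y i))^2
      = ∑ i, ∑ j, ∑ y : Fin n → Y, (∏ k, w k (y k)) * (f i (y i) * f j (y j)) := by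
        have e : ∀ y : Fin n → Y, (∏ i, w i (y i)) * (∑ i, f i (y i))^2 =
            ∑ i, ∑ j, (∏ k, w k (y k)) * (f i (y i) * f j (y j)) := by
          intro y
          rw [sq, Finset.sum_mul_sum]
          simp only [Finset.mul_sum]
        simp only [e]
        rw [Finset.sum_comm]
        refine Finset.sum_congr rfl fun i _ => ?_
        rw [Finset.sum_comm]
    _ ≤ ∑ i : Fin n, ∑ j : Fin n, (if i = j then 1 else 0 : ℝ) :=
        Finset.sum_le_sum fun i _ => Finset.sum_le_sum fun j _ => key i j
    _ = n := by simp

/-- Chebyshev. -/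
lemma di_cheb {Y : Type*} [Fintype Y] {n : ℕ} (w g : Fin n → Y → ℝ)
    (hw : ∀ i, IsDist (w i)) (hg : ∀ i z, 0 ≤ g i z ∧ g i z ≤ 1) (τ : ℝ) (hτ : 0 < τ)
    (E : Finset (Fin n → Y))
    (hE : ∀ y ∈ E, τ ≤ |∑ i, g i (y i) - ∑ i, ∑ z, w i z * g i z|) :
    ∑ y ∈ E, ∏ i, w i (y i) ≤ n / τ^2 := by
  classical
  set μ : Fin n → ℝ := fun i => ∑ z, w i z * g i z with hμ
  have hμ0 : ∀ i, 0 ≤ μ i := fun i =>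
    Finset.sum_nonneg fun z _ => mul_nonneg ((hw i).1 z) (hg i z).1
  have hμ1 : ∀ i, μ i ≤ 1 := fun i => by
    rw [← (hw i).2]
    exact Finset.sum_le_sum fun z _ => mul_le_of_le_one_right ((hw i).1 z) (hg i z).2
  have hm := di_second_moment w (fun i z => g i z - μ i) hw
    (by
      intro i
      simp only [mul_sub, Finset.sum_sub_distrib, ← Finset.sum_mul, (hw i).2, one_mul]
      simp [hμ])
    (by
      intro i
      rw [← (hw i).2]
      refine Finset.sum_le_sum fun z _ => mul_le_of_le_one_right ((hw i).1 z) ?_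
      have := hg i z
      have := hμ0 i
      have := hμ1 i
      rw [sq_le_one_iff_abs_le_one, abs_le]
      constructor <;> linarith [(hg i z).1, (hg i z).2])
  have hnn : ∀ y : Fin n → Y, 0 ≤ ∏ i, w i (y i) :=
    fun y => Finset.prod_nonneg fun i _ => (hw i).1 _
  rw [le_div_iff₀ (by positivity), Finset.sum_mul]
  refine le_trans ?_ hm
  refine le_trans ?_ (Finset.sum_le_sum_of_subset_of_nonneg (Finset.subset_univ E)
    (fun y _ _ => mul_nonneg (hnn y) (sq_nonneg _)))
  refine Finset.sum_le_sum fun y hy => mul_le_mul_of_nonneg_left ?_ (hnn y)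
  have := hE y hy
  rw [Finset.sum_sub_distrib, ← sq_abs (∑ i, g i (y i) - _)]
  exact pow_le_pow_left₀ hτ.le this 2

lemma di_compl {Y : Type*} [Fintype Y] [DecidableEq Y] {n : ℕ} (w : Fin n → Y → ℝ)
    (hw : ∀ i, IsDist (w i)) (E : Finset (Fin n → Y)) :
    ∑ y ∈ E, ∏ i, w i (y i) = 1 - ∑ y ∈ Eᶜ, ∏ i, w i (y i) := by
  rw [← di_prod_sum_one w hw, ← Finset.sum_add_sum_compl E]
  ring

/-- Code criterion. -/
lemma di_code_of_sep {X Y : Type*} [Fintype Y] (W : X → Y → ℝ) (hW : ∀ x, IsDist (W x))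
    (y0 : Y) (n N : ℕ) (l1 l2 τ : ℝ) (hτ : 0 < τ) (h1 : n / τ^2 ≤ l1) (h2 : n / τ^2 ≤ l2)
    (u : Fin N → Fin n → X)
    (hV : ∀ j k, ∑ i, W (u j i) y0 * (1 - W (u j i) y0) ≤
      ∑ i, W (u k i) y0 * (1 - W (u k i) y0) + 1)
    (hd : ∀ j k, j ≠ k → 2 * τ + 1 ≤ ∑ i, (W (u j i) y0 - W (u k i) y0)^2) :
    diCode W n N l1 l2 := by
  classical
  have hle : ∀ x, W x y0 ≤ 1 := fun x => by
    rw [← (hW x).2]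
    exact Finset.single_le_sum (f := W x) (fun z _ => (hW x).1 z) (Finset.mem_univ y0)
  let g : Fin N → Fin n → Y → ℝ := fun j i z => ((if z = y0 then 1 else 0) - W (u j i) y0)^2
  have hg : ∀ j i z, 0 ≤ g j i z ∧ g j i z ≤ 1 := by
    intro j i z
    refine ⟨sq_nonneg _, ?_⟩
    have h0 := (hW (u j i)).1 y0
    have h1 := hle (u j i)
    simp only [g]
    rw [sq_le_one_iff_abs_le_one, abs_le]
    split_ifs <;> constructor <;> linarith
  have hmean : ∀ j k i, ∑ z, W (u k i) z * g j i z =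
      W (u k i) y0 * (1 - W (u k i) y0) + (W (u j i) y0 - W (u k i) y0)^2 := by
    intro j k i
    have : ∀ z, W (u k i) z * g j i z = (if z = y0 then W (u k i) z * (1 - 2 * W (u j i) y0) else 0)
        + W (u k i) z * (W (u j i) y0)^2 := by
      intro z
      simp only [g]
      split_ifs <;> ring
    simp only [this, Finset.sum_add_distrib, ← Finset.sum_mul, (hW _).2, Finset.sum_ite_eq',
      Finset.mem_univ, if_true]
    ring
  refine ⟨u, fun j => Finset.univ.filter fun y =>
    ∑ i, g j i (y i) < ∑ i, W (u j i) y0 * (1 - W (u j i) y0) + τ, ?_, ?_⟩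
  · intro j
    unfold probOf prodP
    rw [di_compl (fun i => W (u j i)) (fun i => hW _)]
    have := di_cheb (fun i => W (u j i)) (g j) (fun i => hW _) (hg j) τ hτ
      (Finset.univ.filter fun y =>
        ∑ i, g j i (y i) < ∑ i, W (u j i) y0 * (1 - W (u j i) y0) + τ)ᶜ (by
        intro y hy
        simp only [Finset.compl_filter, Finset.mem_filter, Finset.mem_univ, true_and, not_lt] at hy
        simp only [hmean, sub_self]
        refine le_trans ?_ (le_abs_self _)
        simp only [ne_eq, OfNat.ofNat_ne_zero, not_false_eq_true, zero_pow, add_zero]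
        linarith)
    linarith
  · intro j k hjk
    unfold probOf prodP
    have := di_cheb (fun i => W (u j i)) (g k) (fun i => hW _) (hg k) τ hτ
      (Finset.univ.filter fun y =>
        ∑ i, g k i (y i) < ∑ i, W (u k i) y0 * (1 - W (u k i) y0) + τ) (by
        intro y hy
        simp only [Finset.mem_filter, Finset.mem_univ, true_and] at hy
        simp only [hmean, Finset.sum_add_distrib]
        refine le_trans ?_ (neg_le_abs _)
        have a := hV k j
        have b := hd k j (Ne.symm hjk)
        linarith)
    linarith

/-- Two-point test and the intermediate value theorem: no maximal code if `l1 + l2 ≥ 1`. -/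
lemma di_sum_lt_one {X Y : Type*} [Fintype Y] (W : X → Y → ℝ) (hW : ∀ x, IsDist (W x))
    (γ : ℝ → Y → ℝ)
    (hγmem : ∀ t ∈ Set.Icc (0 : ℝ) 1, ∃ x, γ t = W x)
    (y0 : Y) (hne : γ 0 y0 ≠ γ 1 y0)
    (hc : ∀ y, ContinuousOn (fun t => γ t y) (Set.Icc 0 1))
    (l1 l2 : ℝ) (h1 : 0 < l1) (h2 : 0 < l2)
    (N : ℕ → ℕ) (hN : ∀ n, IsGreatest {m : ℕ | diCode W n m l1 l2} (N n)) :
    l1 + l2 < 1 := by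
  classical
  by_contra hcon
  push Not at hcon
  suffices h : ∃ n, ∃ t ∈ Set.Icc (0:ℝ) 1, ∃ E : Finset (Fin n → Y),
      1 - l1 ≤ ∑ y ∈ E, ∏ i, γ t (y i) ∧ ∑ y ∈ E, ∏ i, γ t (y i) ≤ l2 by
    obtain ⟨n, t, ht, E, hE1, hE2⟩ := h
    obtain ⟨x, hx⟩ := hγmem t ht
    have hcode : diCode W n (N n + 1) l1 l2 := by
      refine ⟨fun _ _ => x, fun _ => E, fun _ => ?_, fun _ _ _ => ?_⟩
      · simpa [probOf, prodP, ← hx] using hE1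
      · simpa [probOf, prodP, ← hx] using hE2
    have := (hN n).2 hcode
    omega
  have hdist : ∀ t ∈ Set.Icc (0:ℝ) 1, IsDist (γ t) := fun t ht => by
    obtain ⟨x, hx⟩ := hγmem t ht
    rw [hx]; exact hW x
  have m0 : (0:ℝ) ∈ Set.Icc (0:ℝ) 1 := by simp
  have m1 : (1:ℝ) ∈ Set.Icc (0:ℝ) 1 := by simp
  by_cases hl2 : 1 ≤ l2
  · refine ⟨0, 0, m0, Finset.univ, ?_⟩
    have := di_prod_sum_one (n := 0) (fun _ => γ 0) (fun _ => hdist 0 m0)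
    rw [this]
    constructor <;> linarith
  push Not at hl2
  set d := |γ 0 y0 - γ 1 y0| with hd
  have hd0 : 0 < d := abs_pos.2 (sub_ne_zero.2 hne)
  obtain ⟨n, hn⟩ := exists_nat_gt (max 1 (4 / d^2 / min l2 (1 - l2)))
  have hmin : 0 < min l2 (1 - l2) := lt_min h2 (by linarith)
  have hn1 : (1:ℝ) < n := lt_of_le_of_lt (le_max_left _ _) hn
  have hn2 : 4 / d^2 / min l2 (1 - l2) < n := lt_of_le_of_lt (le_max_right _ _) hn
  have hbound : (n:ℝ) / (n * d / 2)^2 ≤ min l2 (1 - l2) := by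
    rw [div_lt_iff₀ hmin, div_lt_iff₀ (by positivity)] at hn2
    rw [div_le_iff₀ (by positivity)]
    have : (n:ℝ) * 4 ≤ n * (n * min l2 (1 - l2) * d^2) :=
      mul_le_mul_of_nonneg_left hn2.le (by linarith)
    nlinarith
  let E : Finset (Fin n → Y) := Finset.univ.filter fun y =>
    |∑ i, (if y i = y0 then (1:ℝ) else 0) - n * γ 0 y0| < n * d / 2
  have hτ : 0 < (n:ℝ) * d / 2 := by positivity
  have hg : ∀ (i : Fin n) (z : Y), 0 ≤ (if z = y0 then (1:ℝ) else 0) ∧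
      (if z = y0 then (1:ℝ) else 0) ≤ 1 := by
    intro i z; split_ifs <;> simp
  have hP0 : l2 ≤ ∑ y ∈ E, ∏ i, γ 0 (y i) := by
    rw [di_compl (fun _ => γ 0) (fun _ => hdist 0 m0)]
    have := di_cheb (fun _ : Fin n => γ 0) (fun _ z => if z = y0 then 1 else 0)
      (fun _ => hdist 0 m0) hg _ hτ Eᶜ (by
        intro y hy
        simp only [E, Finset.compl_filter, Finset.mem_filter, Finset.mem_univ, true_and, not_lt]
          at hy
        simpa using hy)
    have := min_le_right l2 (1 - l2)
    linarith
  have hP1 : ∑ y ∈ E, ∏ i, γ 1 (y i) ≤ l2 := by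
    have := di_cheb (fun _ : Fin n => γ 1) (fun _ z => if z = y0 then 1 else 0)
      (fun _ => hdist 1 m1) hg _ hτ E (by
        intro y hy
        simp only [E, Finset.mem_filter, Finset.mem_univ, true_and] at hy
        have e : ∑ i : Fin n, ∑ z, γ 1 z * (if z = y0 then (1:ℝ) else 0) = n * γ 1 y0 := by simp
        rw [e]
        have tri := abs_sub_le ((n:ℝ) * γ 0 y0) (∑ i, (if y i = y0 then (1:ℝ) else 0)) (n * γ 1 y0)
        rw [← mul_sub, abs_mul, abs_of_pos (by linarith : (0:ℝ) < n), ← hd,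
          abs_sub_comm (n * γ 0 y0)] at tri
        linarith)
    have := min_le_left l2 (1 - l2)
    linarith
  have hcont : ContinuousOn (fun t => ∑ y ∈ E, ∏ i, γ t (y i)) (Set.Icc 0 1) :=
    continuousOn_finsetSum _ fun y _ => continuousOn_finsetProd _ fun i _ => hc (y i)
  obtain ⟨t, ht, hte⟩ := intermediate_value_Icc' zero_le_one hcont ⟨hP1, hP0⟩
  refine ⟨n, t, ht, E, ?_, ?_⟩
  · simp only at hte; rw [hte]; linarith
  · simp only at hte; rw [hte]

/-- Converse bound. -/
lemma di_prod_diff {Y : Type*} [Fintype Y] (n : ℕ) (w v : Fin n → Y → ℝ)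
    (hw : ∀ i, IsDist (w i)) (hv : ∀ i, IsDist (v i)) :
    ∑ y : Fin n → Y, |∏ i, w i (y i) - ∏ i, v i (y i)| ≤ ∑ i, ∑ z, |w i z - v i z| := by
  classical
  induction n with
  | zero => simp
  | succ n ih =>
    rw [← (Fin.consEquiv (fun _ : Fin (n+1) => Y)).sum_comp, Fintype.sum_prod_type]
    simp only [Fin.consEquiv_apply, Fin.prod_univ_succ, Fin.cons_zero, Fin.cons_succ,
      Fin.sum_univ_succ]
    have ih' := ih (fun i => w i.succ) (fun i => v i.succ) (fun i => hw _) (fun i => hv _)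
    have s1 := di_prod_sum_one (fun i : Fin n => w i.succ) (fun i => hw _)
    have nn : ∀ y : Fin n → Y, 0 ≤ ∏ i, w (Fin.succ i) (y i) :=
      fun y => Finset.prod_nonneg fun i _ => (hw _).1 _
    calc ∑ z, ∑ y : Fin n → Y, |w 0 z * ∏ i, w (Fin.succ i) (y i) - v 0 z * ∏ i, v (Fin.succ i) (y i)|
        ≤ ∑ z, ∑ y : Fin n → Y, (|w 0 z - v 0 z| * ∏ i, w (Fin.succ i) (y i)
          + v 0 z * |∏ i, w (Fin.succ i) (y i) - ∏ i, v (Fin.succ i) (y i)|) := by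
          refine Finset.sum_le_sum fun z _ => Finset.sum_le_sum fun y _ => ?_
          have h0 := (hv 0).1 z
          calc _ = |(w 0 z - v 0 z) * ∏ i, w (Fin.succ i) (y i)
            + v 0 z * (∏ i, w (Fin.succ i) (y i) - ∏ i, v (Fin.succ i) (y i))| := by ring_nf
            _ ≤ _ := abs_add_le _ _
            _ = _ := by rw [abs_mul, abs_mul, abs_of_nonneg h0, abs_of_nonneg (nn y)]
      _ = ∑ z, |w 0 z - v 0 z| + ∑ y : Fin n → Y, |∏ i, w (Fin.succ i) (y i) - ∏ i, v (Fin.succ i) (y i)| := by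
          simp only [Finset.sum_add_distrib, ← Finset.mul_sum, s1, mul_one, ← Finset.sum_mul,
            (hv 0).2, one_mul]
      _ ≤ _ := by linarith

lemma di_converse {X Y : Type*} [Fintype Y] (W : X → Y → ℝ) (hW : ∀ x, IsDist (W x))
    (n N M : ℕ) (l1 l2 : ℝ) (hM : (n:ℝ) * Fintype.card Y < (1 - l1 - l2) * M)
    (hcode : diCode W n N l1 l2) : N ≤ (M+1)^(n * Fintype.card Y) := by
  classical
  obtain ⟨u, E, hE1, hE2⟩ := hcode
  have hle : ∀ x y, W x y ≤ 1 := fun x y => by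
    rw [← (hW x).2]
    exact Finset.single_le_sum (f := W x) (fun z _ => (hW x).1 z) (Finset.mem_univ y)
  have hM0 : 0 < M := by
    rcases Nat.eq_zero_or_pos M with h | h
    · subst h
      have : (0:ℝ) ≤ (n:ℝ) * Fintype.card Y := by positivity
      simp at hM; linarith
    · exact h
  have hM0' : (0:ℝ) < M := by exact_mod_cast hM0
  let q : Fin N → (Fin n × Y → Fin (M+1)) := fun j p => ⟨⌊W (u j p.1) p.2 * M⌋₊, by
    apply Nat.lt_succ_of_le
    apply Nat.floor_le_of_le
    exact mul_le_of_le_one_left hM0'.le (hle _ _)⟩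
  have hq : Function.Injective q := by
    intro j k hjk
    by_contra hne
    have hcl : ∀ i z, |W (u j i) z - W (u k i) z| ≤ 1 / M := by
      intro i z
      have h := congrArg Fin.val (congrFun hjk (i, z))
      simp only [q] at h
      have a1 := Nat.floor_le (mul_nonneg ((hW (u j i)).1 z) hM0'.le)
      have a2 := Nat.floor_le (mul_nonneg ((hW (u k i)).1 z) hM0'.le)
      have b1 := Nat.lt_floor_add_one (W (u j i) z * M)
      have b2 := Nat.lt_floor_add_one (W (u k i) z * M)
      rw [h] at a1 b1
      rw [le_div_iff₀ hM0', ← abs_of_pos hM0', ← abs_mul, abs_le]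
      constructor <;> linarith
    have hsum := di_prod_diff n (fun i => W (u j i)) (fun i => W (u k i)) (fun i => hW _)
      (fun i => hW _)
    have hsum2 : ∑ i, ∑ z, |W (u j i) z - W (u k i) z| ≤ n * Fintype.card Y * (1 / M) := by
      calc _ ≤ ∑ i : Fin n, ∑ z : Y, (1 / M : ℝ) :=
            Finset.sum_le_sum fun i _ => Finset.sum_le_sum fun z _ => hcl i z
        _ = _ := by simp; ring
    have hlow : 1 - l1 - l2 ≤ ∑ y : Fin n → Y, |∏ i, W (u j i) (y i) - ∏ i, W (u k i) (y i)| := by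
      have c1 := hE1 j
      have c2 := hE2 k j (Ne.symm hne)
      calc 1 - l1 - l2 ≤ probOf W (u j) (E j) - probOf W (u k) (E j) := by linarith
        _ = ∑ y ∈ E j, (∏ i, W (u j i) (y i) - ∏ i, W (u k i) (y i)) := by
            simp [probOf, prodP]
        _ ≤ ∑ y ∈ E j, |∏ i, W (u j i) (y i) - ∏ i, W (u k i) (y i)| :=
            Finset.sum_le_sum fun y _ => le_abs_self _
        _ ≤ _ := Finset.sum_le_sum_of_subset_of_nonneg (Finset.subset_univ _)
            fun _ _ _ => abs_nonneg _
    have : 1 - l1 - l2 ≤ n * Fintype.card Y / M := by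
      rw [div_eq_mul_one_div]; linarith
    rw [le_div_iff₀ hM0'] at this
    linarith
  have := Fintype.card_le_of_injective q hq
  simpa using this

lemma di_ball {n m : ℕ} (hm : 0 < m) (D : ℕ) (u : Fin n → Fin m) :
    (Finset.univ.filter fun v : Fin n → Fin m => hammingDist u v ≤ D).card ≤ 2^n * m^D := by
  classical
  have hsub : (Finset.univ.filter fun v : Fin n → Fin m => hammingDist u v ≤ D) ⊆
      ((Finset.univ : Finset (Finset (Fin n))).filter fun A => A.card ≤ D).biUnion fun A =>
        Fintype.piFinset fun i => if i ∈ A then Finset.univ else {u i} := by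
    intro v hv
    simp only [Finset.mem_filter, Finset.mem_univ, true_and] at hv
    simp only [Finset.mem_biUnion, Finset.mem_filter, Finset.mem_univ, true_and,
      Fintype.mem_piFinset]
    refine ⟨Finset.univ.filter fun i => u i ≠ v i, hv, fun i => ?_⟩
    by_cases h : u i = v i <;> simp [h]
  refine (Finset.card_le_card hsub).trans (Finset.card_biUnion_le.trans ?_)
  calc _ ≤ ∑ A ∈ (Finset.univ : Finset (Finset (Fin n))).filter (fun A => A.card ≤ D), m^D := by
        refine Finset.sum_le_sum fun A hA => ?_
        simp only [Finset.mem_filter, Finset.mem_univ, true_and] at hA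
        rw [Fintype.card_piFinset]
        have : ∀ i, (if i ∈ A then (Finset.univ : Finset (Fin m)) else {u i}).card
            = if i ∈ A then m else 1 := by
          intro i; split_ifs <;> simp
        simp only [this]
        rw [Finset.prod_ite_mem]
        simp only [Finset.univ_inter, Finset.prod_const]
        exact Nat.pow_le_pow_right hm hA
    _ ≤ ∑ A : Finset (Fin n), m^D :=
        Finset.sum_le_sum_of_subset_of_nonneg (Finset.subset_univ _) fun _ _ _ => Nat.zero_le _
    _ = _ := by simp

lemma di_gv {n m : ℕ} (hm : 0 < m) (D B : ℕ) (F : (Fin n → Fin m) → ℕ) (hF : ∀ v, F v < B) :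
    ∃ S : Finset (Fin n → Fin m), (∀ v ∈ S, ∀ w ∈ S, F v = F w) ∧
      (∀ v ∈ S, ∀ w ∈ S, v ≠ w → D < hammingDist v w) ∧
      m^n ≤ S.card * (2^n * m^D) * B := by
  classical
  -- colour class
  have hcol : ∃ c ∈ Finset.range B, m^n ≤ (Finset.univ.filter fun v => F v = c).card * B := by
    by_contra hcon
    push Not at hcon
    have h := Finset.card_eq_sum_card_fiberwise (s := Finset.univ) (t := Finset.range B) (f := F)
      (by intro v _; simpa using hF v)
    have hcard : (Finset.univ : Finset (Fin n → Fin m)).card = m^n := by simp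
    rw [hcard] at h
    have hB : (Finset.range B).Nonempty := by
      have := hF (fun _ => ⟨0, hm⟩)
      exact ⟨0, by simp; omega⟩
    have h2 : ∑ c ∈ Finset.range B, (Finset.univ.filter fun v => F v = c).card * B
        < ∑ c ∈ Finset.range B, m^n := Finset.sum_lt_sum_of_nonempty hB hcon
    rw [← Finset.sum_mul, ← h] at h2
    simp at h2
    rw [mul_comm] at h2
    exact lt_irrefl _ h2
  obtain ⟨c, -, hc⟩ := hcol
  set C := Finset.univ.filter fun v : Fin n → Fin m => F v = c with hC
  let P : Finset (Finset (Fin n → Fin m)) := C.powerset.filter fun S =>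
    ∀ v ∈ S, ∀ w ∈ S, v ≠ w → D < hammingDist v w
  have hP : P.Nonempty := ⟨∅, by simp [P]⟩
  obtain ⟨S, hS, hmax⟩ := P.exists_max_image Finset.card hP
  simp only [P, Finset.mem_filter, Finset.mem_powerset] at hS
  refine ⟨S, ?_, hS.2, ?_⟩
  · intro v hv w hw
    have a := hS.1 hv
    have b := hS.1 hw
    simp only [hC, Finset.mem_filter, Finset.mem_univ, true_and] at a b
    rw [a, b]
  · have hcov : C ⊆ S.biUnion fun u => Finset.univ.filter fun v => hammingDist u v ≤ D := by
      intro v hv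
      by_contra hcon
      simp only [Finset.mem_biUnion, Finset.mem_filter, Finset.mem_univ, true_and, not_exists,
        not_and, not_le] at hcon
      have hvS : v ∉ S := fun h => by simpa using hcon v h
      have := hmax (insert v S) (by
        simp only [P, Finset.mem_filter, Finset.mem_powerset]
        refine ⟨Finset.insert_subset hv hS.1, ?_⟩
        intro a ha b hb hab
        rw [Finset.mem_insert] at ha hb
        rcases ha with rfl | ha <;> rcases hb with rfl | hb
        · exact absurd rfl hab
        · rw [hammingDist_comm]; exact hcon b hb
        · exact hcon a ha
        · exact hS.2 a ha b hb hab)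
      rw [Finset.card_insert_of_notMem hvS] at this
      omega
    refine hc.trans (Nat.mul_le_mul_right _ ?_)
    refine (Finset.card_le_card hcov).trans (Finset.card_biUnion_le.trans ?_)
    calc _ ≤ ∑ u ∈ S, 2^n * m^D := Finset.sum_le_sum fun u _ => di_ball hm D u
      _ = _ := by simp

/-- The code construction. -/
lemma di_construct {X Y : Type*} [Fintype Y] (W : X → Y → ℝ) (hW : ∀ x, IsDist (W x))
    (y0 : Y) (a d : ℝ) (n m D : ℕ) (hm : 0 < m) (α : Fin m → X)
    (hα : ∀ i, W (α i) y0 = a + d * (i : ℕ) / m)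
    (l1 l2 τ : ℝ) (hτ : 0 < τ) (h1 : n / τ^2 ≤ l1) (h2 : n / τ^2 ≤ l2)
    (hsep : 2 * τ + 1 ≤ ((D:ℝ) + 1) * (d^2 / m^2)) :
    ∃ N, diCode W n N l1 l2 ∧ m^n ≤ N * (2^n * m^D) * (n+1) := by
  classical
  have hle : ∀ x y, W x y ≤ 1 := fun x y => by
    rw [← (hW x).2]
    exact Finset.single_le_sum (f := W x) (fun z _ => (hW x).1 z) (Finset.mem_univ y)
  let V : (Fin n → Fin m) → ℝ := fun v => ∑ i, W (α (v i)) y0 * (1 - W (α (v i)) y0)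
  have hV0 : ∀ v, 0 ≤ V v := fun v => Finset.sum_nonneg fun i _ =>
    mul_nonneg ((hW _).1 _) (sub_nonneg.2 (hle _ _))
  have hV1 : ∀ v, V v ≤ n := fun v => by
    calc V v ≤ ∑ i : Fin n, (1:ℝ) := Finset.sum_le_sum fun i _ => by
          nlinarith [hle (α (v i)) y0, (hW (α (v i))).1 y0]
      _ = n := by simp
  obtain ⟨S, hS1, hS2, hS3⟩ := di_gv hm D (n+1) (fun v => ⌊V v⌋₊)
    (fun v => Nat.lt_succ_of_le (Nat.floor_le_of_le (hV1 v)))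
  refine ⟨S.card, ?_, hS3⟩
  let e := S.equivFin.symm
  refine di_code_of_sep W hW y0 n S.card l1 l2 τ hτ h1 h2 (fun j i => α ((e j).1 i)) ?_ ?_
  · intro j k
    have h := hS1 _ (e j).2 _ (e k).2
    have a1 := Nat.lt_floor_add_one (V (e j).1)
    have a2 := Nat.floor_le (hV0 (e k).1)
    rw [h] at a1
    show V (e j).1 ≤ V (e k).1 + 1
    linarith
  · intro j k hjk
    have hne : (e j).1 ≠ (e k).1 := fun h => hjk (e.injective (Subtype.ext h))
    have hH := hS2 _ (e j).2 _ (e k).2 hne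
    refine hsep.trans ?_
    have hm' : (0:ℝ) < m := by exact_mod_cast hm
    calc ((D:ℝ) + 1) * (d^2 / m^2) ≤ (hammingDist (e j).1 (e k).1 : ℝ) * (d^2 / m^2) := by
          apply mul_le_mul_of_nonneg_right _ (by positivity)
          exact_mod_cast hH
      _ = ∑ i ∈ Finset.univ.filter (fun i => (e j).1 i ≠ (e k).1 i), (d^2 / m^2 : ℝ) := by
          simp [hammingDist]
      _ ≤ ∑ i ∈ Finset.univ.filter (fun i => (e j).1 i ≠ (e k).1 i),
          (W (α ((e j).1 i)) y0 - W (α ((e k).1 i)) y0)^2 := by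
          refine Finset.sum_le_sum fun i hi => ?_
          simp only [Finset.mem_filter, Finset.mem_univ, true_and] at hi
          rw [hα, hα]
          have : (1:ℝ) ≤ ((((e j).1 i : ℕ) : ℝ) - (((e k).1 i : ℕ) : ℝ))^2 := by
            have h0 : (((e j).1 i : ℕ) : ℤ) - (((e k).1 i : ℕ) : ℤ) ≠ 0 := by
              intro h; apply hi; apply Fin.ext; omega
            have : (1:ℤ) ≤ ((((e j).1 i : ℕ) : ℤ) - (((e k).1 i : ℕ) : ℤ))^2 := by
              have := sq_pos_of_ne_zero h0
              omega
            exact_mod_cast this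
          have e1 : (a + d * (((e j).1 i : ℕ) : ℝ) / m - (a + d * (((e k).1 i : ℕ) : ℝ) / m))^2
            = (d^2 / m^2) * ((((e j).1 i : ℕ) : ℝ) - (((e k).1 i : ℕ) : ℝ))^2 := by
            field_simp; ring
          rw [e1]
          exact le_mul_of_one_le_right (by positivity) this
      _ ≤ _ := Finset.sum_le_sum_of_subset_of_nonneg (Finset.subset_univ _)
          fun _ _ _ => sq_nonneg _

set_option maxHeartbeats 1000000 in
lemma di_lower {X Y : Type*} [Fintype Y] (W : X → Y → ℝ) (hW : ∀ x, IsDist (W x))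
    (y0 : Y) (a d : ℝ) (hd : d ≠ 0)
    (hval : ∀ s ∈ Set.Icc (0:ℝ) 1, ∃ x, W x y0 = a + d * s)
    (l1 l2 : ℝ) (h1 : 0 < l1) (h2 : 0 < l2)
    (N : ℕ → ℕ) (hN : ∀ n, IsGreatest {m : ℕ | diCode W n m l1 l2} (N n))
    (t : ℝ) (ht0 : 0 < t) (ht1 : t < 1) :
    ∀ᶠ n : ℕ in atTop, (1 - t) / 4 - t ≤ Real.logb 2 (N n) / ((n : ℝ) * Real.logb 2 n) := by
  obtain ⟨K, hK⟩ := exists_nat_gt (max 1 (1 / min l1 l2))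
  have hmin : 0 < min l1 l2 := lt_min h1 h2
  have hK1 : (1:ℝ) < K := lt_of_le_of_lt (le_max_left _ _) hK
  have hK2 : 1 / min l1 l2 < K := lt_of_le_of_lt (le_max_right _ _) hK
  have hK3 : 1 / (K:ℝ)^2 ≤ min l1 l2 := by
    rw [div_lt_iff₀ hmin] at hK2
    rw [div_le_iff₀ (by positivity)]
    nlinarith
  set c0 : ℝ := Real.sqrt (t * d^2 / (2 * K + 1)) with hc0
  have hc0pos : 0 < c0 := Real.sqrt_pos.2 (by positivity)
  have hc0sq : c0^2 * (2 * K + 1) = t * d^2 := by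
    rw [hc0, Real.sq_sqrt (by positivity)]
    field_simp
  have hx : Tendsto (fun n : ℕ => (n:ℝ)^(1/4:ℝ)) atTop atTop :=
    (tendsto_rpow_atTop (by norm_num)).comp tendsto_natCast_atTop_atTop
  have hlog : Tendsto (fun n : ℕ => Real.log n) atTop atTop :=
    Real.tendsto_log_atTop.comp tendsto_natCast_atTop_atTop
  filter_upwards [hx.eventually_ge_atTop (2 / c0),
    hlog.eventually_ge_atTop ((2 + |Real.log (c0/2)|) / t), eventually_ge_atTop 2]
    with n hn1 hn2 hn3
  have hn : (2:ℝ) ≤ n := by exact_mod_cast hn3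
  have hnpos : (0:ℝ) < n := by linarith
  set x : ℝ := (n:ℝ)^(1/4:ℝ) with hxdef
  have hxpos : 0 < x := Real.rpow_pos_of_pos hnpos _
  have hxsq : x^2 = Real.sqrt n := by
    rw [hxdef, Real.sqrt_eq_rpow, ← Real.rpow_natCast, ← Real.rpow_mul hnpos.le]
    norm_num
  have hxlog : Real.log x = 1/4 * Real.log n := Real.log_rpow hnpos _
  have hlogn : 0 < Real.log n := Real.log_pos (by linarith)
  have hs1 : 1 ≤ Real.sqrt n := by
    rw [Real.one_le_sqrt]; linarith
  have hss : Real.sqrt n * Real.sqrt n = n := Real.mul_self_sqrt hnpos.le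
  have hcx : 2 ≤ c0 * x := by
    rw [div_le_iff₀ hc0pos] at hn1; linarith
  set m : ℕ := ⌊c0 * x⌋₊ with hm
  have hm1 : (m:ℝ) ≤ c0 * x := Nat.floor_le (by positivity)
  have hm2 : c0 / 2 * x ≤ m := by
    have := Nat.lt_floor_add_one (c0 * x)
    rw [← hm] at this
    linarith
  have hmpos' : (0:ℝ) < m := lt_of_lt_of_le (by positivity) hm2
  have hmpos : 0 < m := by exact_mod_cast hmpos'
  have hm1' : (1:ℝ) ≤ m := by exact_mod_cast hmpos
  set D : ℕ := ⌊t * n⌋₊ with hD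
  have hD1 : (D:ℝ) ≤ t * n := Nat.floor_le (by positivity)
  have hD2 : t * n < D + 1 := Nat.lt_floor_add_one _
  have hα : ∀ i : Fin m, ∃ z, W z y0 = a + d * (i : ℕ) / m := by
    intro i
    obtain ⟨z, hz⟩ := hval ((i:ℕ) / (m:ℝ)) ⟨by positivity, by
      rw [div_le_one hmpos']
      exact_mod_cast i.2.le⟩
    exact ⟨z, by rw [hz, mul_div_assoc]⟩
  choose α hα using hα
  have hτ : 0 < (K:ℝ) * Real.sqrt n := by positivity
  have hτ2 : (n:ℝ) / (K * Real.sqrt n)^2 ≤ min l1 l2 := by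
    rw [mul_pow, Real.sq_sqrt hnpos.le]
    refine le_trans (le_of_eq ?_) hK3
    field_simp
  have hsep : 2 * (K * Real.sqrt n) + 1 ≤ ((D:ℝ) + 1) * (d^2 / m^2) := by
    rw [← mul_div_assoc, le_div_iff₀ (by positivity)]
    have hmsq : (m:ℝ)^2 ≤ c0^2 * Real.sqrt n := by
      rw [← hxsq, ← mul_pow]
      exact pow_le_pow_left₀ hmpos'.le hm1 2
    calc (2 * (K * Real.sqrt n) + 1) * (m:ℝ)^2
        ≤ ((2 * K + 1) * Real.sqrt n) * (c0^2 * Real.sqrt n) := by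
          apply mul_le_mul _ hmsq (by positivity) (by positivity)
          linarith
      _ = c0^2 * (2 * K + 1) * (Real.sqrt n * Real.sqrt n) := by ring
      _ = t * n * d^2 := by rw [hss, hc0sq]; ring
      _ ≤ _ := mul_le_mul_of_nonneg_right hD2.le (sq_nonneg _)
  obtain ⟨N', hN', hcard⟩ := di_construct W hW y0 a d n m D hmpos α hα l1 l2 _ hτ
    (hτ2.trans (min_le_left _ _)) (hτ2.trans (min_le_right _ _)) hsep
  have hNN : N' ≤ N n := (hN n).2 hN'
  have hcard2 : m^n ≤ N n * (2^n * m^D) * (n+1) :=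
    hcard.trans (Nat.mul_le_mul_right _ (Nat.mul_le_mul_right _ hNN))
  have hNpos : 0 < N n := by
    rcases Nat.eq_zero_or_pos (N n) with h | h
    · rw [h] at hcard2
      have : 0 < m^n := by positivity
      simp at hcard2; omega
    · exact h
  have hNpos' : (0:ℝ) < N n := by exact_mod_cast hNpos
  have hcard3 : (m:ℝ)^n ≤ N n * (2^n * m^D) * (n+1) := by exact_mod_cast hcard2
  have hl := Real.log_le_log (by positivity) hcard3
  rw [Real.log_mul (by positivity) (by positivity), Real.log_mul (by positivity) (by positivity),
    Real.log_mul (by positivity) (by positivity), Real.log_pow, Real.log_pow, Real.log_pow] at hl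
  have hl2 : Real.log 2 ≤ 1 := by linarith [Real.log_le_sub_one_of_pos (show (0:ℝ) < 2 by norm_num)]
  have hln : Real.log ((n:ℝ)+1) ≤ n := by
    linarith [Real.log_le_sub_one_of_pos (show (0:ℝ) < (n:ℝ)+1 by positivity)]
  have hlm0 : 0 ≤ Real.log m := Real.log_nonneg hm1'
  have hlm : Real.log (c0/2) + 1/4 * Real.log n ≤ Real.log m := by
    rw [← hxlog, ← Real.log_mul (by positivity) (by positivity)]
    exact Real.log_le_log (by positivity) hm2
  have hDl : (D:ℝ) * Real.log m ≤ t * n * Real.log m := mul_le_mul_of_nonneg_right hD1 hlm0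
  rw [div_le_iff₀ ht0] at hn2
  have hB : ((1 - t) / 4 - t) * Real.log n ≤ (1 - t) * Real.log m - 2 := by
    have e1 := mul_le_mul_of_nonneg_left hlm (sub_nonneg.2 ht1.le)
    have e2 : -|Real.log (c0/2)| ≤ (1 - t) * Real.log (c0/2) := by
      have := neg_abs_le (Real.log (c0/2))
      have := abs_nonneg (Real.log (c0/2))
      nlinarith
    linarith
  have hfin : ((1 - t) / 4 - t) * (n * Real.log n) ≤ Real.log (N n) := by
    have := mul_le_mul_of_nonneg_left hB hnpos.le
    have h3 : (n:ℝ) * Real.log 2 ≤ n := mul_le_of_le_one_right hnpos.le hl2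
    linarith
  have hlog2 : 0 < Real.log 2 := Real.log_pos (by norm_num)
  have e : Real.logb 2 (N n) / ((n : ℝ) * Real.logb 2 n) = Real.log (N n) / (n * Real.log n) := by
    unfold Real.logb
    field_simp
  rw [e, le_div_iff₀ (by positivity)]
  exact hfin

lemma di_upper {X Y : Type*} [Fintype Y] (W : X → Y → ℝ) (hW : ∀ x, IsDist (W x))
    (l1 l2 : ℝ) (hl : l1 + l2 < 1)
    (N : ℕ → ℕ) (hN : ∀ n, IsGreatest {m : ℕ | diCode W n m l1 l2} (N n)) :
    ∀ᶠ n : ℕ in atTop, Real.logb 2 (N n) / ((n : ℝ) * Real.logb 2 n)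
      ≤ 2 * Fintype.card Y := by
  have hδ : 0 < 1 - l1 - l2 := by linarith
  obtain ⟨L, hL⟩ := exists_nat_gt ((Fintype.card Y : ℝ) / (1 - l1 - l2))
  rw [div_lt_iff₀ hδ] at hL
  filter_upwards [eventually_ge_atTop (L + 2)] with n hn
  have hn2 : (2:ℝ) ≤ n := by exact_mod_cast (by omega : 2 ≤ n)
  have hle := di_converse W hW n (N n) (n * L) l1 l2 (by push_cast; nlinarith) (hN n).1
  have hle2 : N n ≤ n ^ (2 * (n * Fintype.card Y)) := by
    refine hle.trans ?_
    rw [pow_mul n 2]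
    apply Nat.pow_le_pow_left
    nlinarith
  have hlogn : 0 < Real.logb 2 n := Real.logb_pos (by norm_num) (by linarith)
  rw [div_le_iff₀ (by positivity)]
  rcases Nat.eq_zero_or_pos (N n) with h | h
  · rw [h]; simp only [Nat.cast_zero, Real.logb_zero]; positivity
  · have h' : (0:ℝ) < N n := by exact_mod_cast h
    have h3 : (N n : ℝ) ≤ (n:ℝ) ^ (2 * (n * Fintype.card Y)) := by exact_mod_cast hle2
    have := Real.logb_le_logb_of_le (b := 2) (by norm_num) h' h3
    rw [Real.logb_pow] at this
    push_cast at this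
    linarith

/-- Corollary (channels containing a continuous curve of output distributions): if the output
set of `W` contains a continuous curve (continuity with respect to the total variation metric)
with distinct endpoints, then the slightly superexponential DI rate is at least `1/4`. -/
theorem stmt9 {X Y : Type*} [Fintype Y] (W : X → Y → ℝ) (hW : ∀ x, IsDist (W x))
    (γ : ℝ → Y → ℝ)
    (hγmem : ∀ t ∈ Set.Icc (0 : ℝ) 1, ∃ x, γ t = W x)
    (hγne : γ 0 ≠ γ 1)
    (hγcont : ∀ t ∈ Set.Icc (0 : ℝ) 1, ∀ ε > (0 : ℝ), ∃ δ > (0 : ℝ),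
      ∀ s ∈ Set.Icc (0 : ℝ) 1, |s - t| < δ → tvd (γ s) (γ t) < ε)
    (l1 l2 : ℝ) (h1 : 0 < l1) (h2 : 0 < l2)
    (N : ℕ → ℕ) (hN : ∀ n, IsGreatest {m : ℕ | diCode W n m l1 l2} (N n)) :
    (1 / 4 : ℝ) ≤ Filter.liminf (fun n : ℕ =>
      Real.logb 2 (N n) / ((n : ℝ) * Real.logb 2 n)) Filter.atTop := by

  have hc : ∀ y, ContinuousOn (fun t => γ t y) (Set.Icc 0 1) := by
    intro y
    rw [Metric.continuousOn_iff]
    intro t ht ε hε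
    obtain ⟨δ, hδ, h⟩ := hγcont t ht (ε / 2) (by linarith)
    refine ⟨δ, hδ, fun s hs hst => ?_⟩
    have h' := h s hs (by rwa [Real.dist_eq] at hst)
    unfold tvd at h'
    rw [Real.dist_eq]
    have := Finset.single_le_sum (f := fun z => |γ s z - γ t z|) (fun z _ => abs_nonneg _)
      (Finset.mem_univ y)
    linarith
  obtain ⟨y0, hy0⟩ := Function.ne_iff.1 hγne
  have hsum := di_sum_lt_one W hW γ hγmem y0 hy0 hc l1 l2 h1 h2 N hN
  have hval : ∀ s ∈ Set.Icc (0:ℝ) 1, ∃ x, W x y0 = γ 0 y0 + (γ 1 y0 - γ 0 y0) * s := by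
    intro s hs
    have hiv := intermediate_value_uIcc (a := (0:ℝ)) (b := 1) (f := fun t => γ t y0)
      (by rw [Set.uIcc_of_le zero_le_one]; exact hc y0)
    have hmem : γ 0 y0 + (γ 1 y0 - γ 0 y0) * s ∈ Set.uIcc (γ 0 y0) (γ 1 y0) := by
      rw [Set.mem_uIcc]
      obtain ⟨hs0, hs1⟩ := hs
      rcases le_total (γ 0 y0) (γ 1 y0) with h | h
      · left; constructor <;> nlinarith
      · right; constructor <;> nlinarith
    obtain ⟨t, ht, hte⟩ := hiv hmem
    rw [Set.uIcc_of_le zero_le_one] at ht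
    obtain ⟨x, hx⟩ := hγmem t ht
    exact ⟨x, by rw [← hx]; exact hte⟩
  have hup := di_upper W hW l1 l2 hsum N hN
  have hbdd : Filter.IsBoundedUnder (· ≤ ·) atTop (fun n : ℕ =>
      Real.logb 2 (N n) / ((n : ℝ) * Real.logb 2 n)) := Filter.isBoundedUnder_of_eventually_le hup
  refine le_of_forall_pos_le_add fun ε hε => ?_
  have ht0 : 0 < min (ε / 2) (1 / 2) := lt_min (by linarith) (by norm_num)
  have ht1 : min (ε / 2) (1 / 2) < 1 := lt_of_le_of_lt (min_le_right _ _) (by norm_num)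
  have hlow := di_lower W hW y0 (γ 0 y0) (γ 1 y0 - γ 0 y0) (sub_ne_zero.2 (Ne.symm hy0)) hval
    l1 l2 h1 h2 N hN _ ht0 ht1
  have hfin := Filter.le_liminf_of_le hbdd.isCoboundedUnder_ge hlow
  have := min_le_left (ε / 2) (1 / 2)
  linarith
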